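/- arXiv:1604.06370 — 2 statements merged into one kernel-verified Lean document; each statement's English description precedes it below -/
import Mathlib

section
/- Let (M,Q) be a two-dimensional random vector with M>0 almost surely and P(M≠1)>0, suppose there exists β>0 such that E[M^β]=1, E[M^β (ln M)⁺]<∞ and E[|Q|^β]<∞, and suppose the law of ln M is concentrated on the lattice dℤ for some d>0. If Y_∞ is a random variable independent of (M,Q) whose law equals the law of Q+M·Y_∞, then limsup_{u→∞} u^β P(Y_∞>u) < ∞. (Grincevičius-type theorem, arithmetic case.) -/
open MeasureTheory ProbabilityTheory Filter Real

theorem exists_lintegral_rpow_eq_lt_one {Ω : Type*} [MeasurableSpace Ω] {μ : Measure Ω}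
    [IsProbabilityMeasure μ] {M : Ω → ℝ} (hM : Measurable M) (hpos : ∀ᵐ ω ∂μ, 0 < M ω)
    (hne : 0 < μ {ω | M ω ≠ 1}) {β p : ℝ} (hp : 0 < p) (hpβ : p < β)
    (hint : Integrable (fun ω => M ω ^ β) μ) (hone : ∫ ω, M ω ^ β ∂μ = 1) :
    ∃ ρ : ℝ, 0 ≤ ρ ∧ ρ < 1 ∧ ∫⁻ ω, ENNReal.ofReal (M ω ^ p) ∂μ = ENNReal.ofReal ρ := by
  have hβ : 0 < β := hp.trans hpβ
  have key : ∀ m : ℝ, 0 < m → m ^ p = (1 + (m ^ β - 1)) ^ (p / β) := fun m hm => by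
    rw [add_sub_cancel, ← rpow_mul hm.le, mul_div_cancel₀ _ hβ.ne']
  have hle : ∀ m : ℝ, 0 < m → m ^ p ≤ 1 + p / β * (m ^ β - 1) := fun m hm => by
    rw [key m hm]
    have := rpow_pos_of_pos hm β
    exact rpow_one_add_le_one_add_mul_self (by linarith) (by positivity)
      ((div_le_one hβ).2 hpβ.le)
  have hlt : ∀ m : ℝ, 0 < m → m ≠ 1 → m ^ p < 1 + p / β * (m ^ β - 1) := fun m hm h1 => by
    rw [key m hm]
    have := rpow_pos_of_pos hm β
    refine rpow_one_add_lt_one_add_mul_self (by linarith) ?_ (by positivity)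
      ((div_lt_one hβ).2 hpβ)
    rw [sub_ne_zero]
    intro h
    exact h1 ((rpow_left_inj hm.le zero_le_one hβ.ne').1 (by rwa [one_rpow]))
  have hb : Integrable (fun ω => 1 + p / β * (M ω ^ β - 1)) μ := by fun_prop
  have hp_int : Integrable (fun ω => M ω ^ p) μ := by
    refine hb.mono' (hM.pow_const p).aestronglyMeasurable ?_
    filter_upwards [hpos] with ω h
    rw [norm_of_nonneg (rpow_nonneg h.le _)]
    exact hle _ h
  have hnn : 0 ≤ᵐ[μ] fun ω => M ω ^ p := by
    filter_upwards [hpos] with ω h using rpow_nonneg h.le _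
  refine ⟨∫ ω, M ω ^ p ∂μ, integral_nonneg_of_ae hnn, ?_,
    (ofReal_integral_eq_lintegral_ofReal hp_int hnn).symm⟩
  have hb1 : ∫ ω, (1 + p / β * (M ω ^ β - 1)) ∂μ = 1 := by
    rw [integral_add (by fun_prop) (by fun_prop), integral_const_mul,
      integral_sub (by fun_prop) (by fun_prop), hone]
    simp
  have hmono : ∀ᵐ ω ∂μ, M ω ^ p ≤ 1 + p / β * (M ω ^ β - 1) := by
    filter_upwards [hpos] with ω h using hle _ h
  refine lt_of_le_of_ne (hb1 ▸ integral_mono_ae hp_int hb hmono) fun heq => hne.ne' ?_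
  rw [← hb1, integral_eq_iff_of_ae_le hp_int hb hmono] at heq
  suffices h : ∀ᵐ ω ∂μ, M ω = 1 from ae_iff.1 h
  filter_upwards [heq, hpos] with ω h1 h2
  by_contra h3
  exact (hlt _ h2 h3).ne h1

theorem le_of_renewal_inequality {Ω : Type*} [MeasurableSpace Ω] {μ : Measure Ω}
    [IsProbabilityMeasure μ] {N : Ω → ℝ} (hN : Measurable N) (hpos : ∀ᵐ ω ∂μ, 0 < N ω) {p : ℝ}
    (hmom : ∫⁻ ω, ENNReal.ofReal (N ω ^ p) ∂μ < 1) {T G g : ℝ → ENNReal}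
    (hT : ∀ v > 0, T v ≤ ∫⁻ ω, T (v * N ω) ∂μ + g v)
    (hG : ∀ v > 0, ∫⁻ ω, G (v * N ω) ∂μ + g v ≤ G v)
    (hsmall : ∀ ε : NNReal, 0 < ε → ∃ A : NNReal, ∀ v > 0,
      T v ≤ ε + A * ENNReal.ofReal (v ^ p)) :
    ∀ v > 0, T v ≤ G v := by
  intro v hv
  refine ENNReal.le_of_forall_pos_le_add fun ε hε _ => ?_
  obtain ⟨A, hA⟩ := hsmall ε hε
  set κ := ∫⁻ ω, ENNReal.ofReal (N ω ^ p) ∂μ with hκ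
  have hiter : ∀ n : ℕ, ∀ v > 0, T v ≤ G v + (ε + κ ^ n * (A * ENNReal.ofReal (v ^ p))) := by
    intro n
    induction n with
    | zero =>
      intro v hv
      simpa using (hA v hv).trans le_add_self
    | succ n ih =>
      intro v hv
      calc T v ≤ ∫⁻ ω, T (v * N ω) ∂μ + g v := hT v hv
        _ ≤ ∫⁻ ω, (G (v * N ω) + (ε + κ ^ n * (A * (ENNReal.ofReal (v ^ p) *
              ENNReal.ofReal (N ω ^ p))))) ∂μ + g v := by
            gcongr ?_ + _
            refine lintegral_mono_ae ?_
            filter_upwards [hpos] with ω hω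
            refine (ih _ (mul_pos hv hω)).trans_eq ?_
            rw [mul_rpow hv.le hω.le, ENNReal.ofReal_mul (rpow_nonneg hv.le _)]
        _ = (∫⁻ ω, G (v * N ω) ∂μ + g v) + (ε + κ ^ (n + 1) * (A * ENNReal.ofReal (v ^ p))) := by
            rw [lintegral_add_right _ (by fun_prop), lintegral_add_right _ (by fun_prop),
              lintegral_const_mul _ (by fun_prop), lintegral_const_mul _ (by fun_prop),
              lintegral_const_mul _ (by fun_prop), ← hκ]
            simp only [lintegral_const, measure_univ, mul_one]
            ring
        _ ≤ _ := by gcongr; exact hG v hv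
  have hlim : Tendsto (fun n : ℕ => G v + (ε + κ ^ n * (A * ENNReal.ofReal (v ^ p)))) atTop
      (nhds (G v + (ε + 0 * (A * ENNReal.ofReal (v ^ p))))) := by
    refine tendsto_const_nhds.add (tendsto_const_nhds.add ?_)
    exact ENNReal.Tendsto.mul_const (ENNReal.tendsto_pow_atTop_nhds_zero_of_lt_one hmom)
      (Or.inr (ENNReal.mul_ne_top ENNReal.coe_ne_top ENNReal.ofReal_ne_top))
  simpa using ge_of_tendsto' hlim fun n => hiter n v hv

theorem exists_lintegral_min_one_rpow_le {Ω : Type*} [MeasurableSpace Ω] {μ : Measure Ω}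
    [IsProbabilityMeasure μ] {Y : Ω → ℝ} (hY : Measurable Y) {p : ℝ} (hp : 0 < p)
    {ε : NNReal} (hε : 0 < ε) :
    ∃ A : NNReal, ∀ v > 0, ∫⁻ ω, ENNReal.ofReal (min 1 (v * |Y ω|) ^ p) ∂μ ≤
      ε + A * ENNReal.ofReal (v ^ p) := by
  have hlim : Tendsto (μ ∘ fun n : ℕ => {ω | (n : ℝ) < |Y ω|}) atTop
      (nhds (μ (⋂ n : ℕ, {ω | (n : ℝ) < |Y ω|}))) := by
    refine tendsto_measure_iInter_atTop (fun n => ?_) ?_ ⟨0, measure_ne_top _ _⟩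
    · exact (measurableSet_lt measurable_const (by fun_prop)).nullMeasurableSet
    · intro a b hab ω (hω : (b : ℝ) < _)
      exact lt_of_le_of_lt (Nat.cast_le.2 hab) hω
  have hempty : (⋂ n : ℕ, {ω | (n : ℝ) < |Y ω|}) = ∅ := by
    ext ω
    simpa using (exists_nat_ge |Y ω|)
  rw [hempty, measure_empty] at hlim
  obtain ⟨n, hn⟩ := (hlim.eventually_le_const (ENNReal.coe_pos.2 hε)).exists
  refine ⟨((n : ℝ) ^ p).toNNReal, fun v hv => ?_⟩
  have hset : MeasurableSet {ω | (n : ℝ) < |Y ω|} :=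
    measurableSet_lt measurable_const (by fun_prop)
  calc ∫⁻ ω, ENNReal.ofReal (min 1 (v * |Y ω|) ^ p) ∂μ
      ≤ ∫⁻ ω, ({ω | (n : ℝ) < |Y ω|}.indicator 1 ω + ENNReal.ofReal ((n : ℝ) ^ p * v ^ p)) ∂μ := by
        refine lintegral_mono fun ω => ?_
        have h0 : 0 ≤ v * |Y ω| := by positivity
        by_cases h : (n : ℝ) < |Y ω|
        · rw [Set.indicator_of_mem (by exact h)]
          refine le_add_right ?_
          simpa using rpow_le_one (le_min zero_le_one h0) (min_le_left _ _) hp.le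
        · rw [Set.indicator_of_notMem (by exact h), zero_add]
          refine ENNReal.ofReal_le_ofReal ?_
          rw [← mul_rpow (by positivity) hv.le]
          refine rpow_le_rpow (le_min zero_le_one h0) ((min_le_right _ _).trans ?_) hp.le
          rw [mul_comm]
          gcongr
          exact not_lt.1 h
    _ = μ {ω | (n : ℝ) < |Y ω|} + ENNReal.ofReal ((n : ℝ) ^ p) * ENNReal.ofReal (v ^ p) := by
        rw [lintegral_add_right _ (by fun_prop), lintegral_indicator_one hset, lintegral_const,
          measure_univ, mul_one, ENNReal.ofReal_mul (by positivity)]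
    _ ≤ _ := by gcongr; exacts [hn, le_rfl]

theorem lintegral_of_indepFun {Ω α γ : Type*} [MeasurableSpace Ω] [MeasurableSpace α]
    [MeasurableSpace γ] {μ : Measure Ω} [IsProbabilityMeasure μ] {X : Ω → α} {Z : Ω → γ}
    (hX : Measurable X) (hZ : Measurable Z) (h : IndepFun X Z μ) {f : α × γ → ENNReal}
    (hf : Measurable f) :
    ∫⁻ ω, f (X ω, Z ω) ∂μ = ∫⁻ ω, ∫⁻ ω', f (X ω', Z ω) ∂μ ∂μ := by
  rw [← lintegral_map (f := f) (g := fun ω => (X ω, Z ω)) hf (by fun_prop),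
    (indepFun_iff_map_prod_eq_prod_map_map hX.aemeasurable hZ.aemeasurable).1 h,
    lintegral_prod_symm _ hf.aemeasurable, lintegral_map (by fun_prop) hZ]
  exact lintegral_congr fun ω => lintegral_map (by fun_prop) hX

theorem lintegral_abs_rpow_ne_top_of_map_eq {Ω : Type*} [MeasurableSpace Ω] {μ : Measure Ω}
    [IsProbabilityMeasure μ] {M Q Y : Ω → ℝ} (hM : Measurable M) (hQ : Measurable Q)
    (hY : Measurable Y) (hpos : ∀ᵐ ω ∂μ, 0 < M ω) {p : ℝ} (hp : 0 < p) {ρ : ℝ} (hρ0 : 0 ≤ ρ)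
    (hρ1 : ρ < 1) (hρ : ∫⁻ ω, ENNReal.ofReal (M ω ^ p) ∂μ = ENNReal.ofReal ρ)
    (hQp : ∫⁻ ω, ENNReal.ofReal (|Q ω| ^ p) ∂μ ≠ ⊤)
    (hindep : IndepFun Y (fun ω => (M ω, Q ω)) μ)
    (hlaw : Measure.map Y μ = Measure.map (fun ω => Q ω + M ω * Y ω) μ) :
    ∫⁻ ω, ENNReal.ofReal (|Y ω| ^ p) ∂μ ≠ ⊤ := by
  obtain ⟨r, hr0, hr1, hrp⟩ : ∃ r : ℝ, 0 < r ∧ r < 1 ∧ ρ < r ^ p := by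
    refine ⟨((1 + ρ) / 2) ^ (1 / p), by positivity,
      rpow_lt_one (by positivity) (by linarith) (by positivity), ?_⟩
    rw [← rpow_mul (by positivity), one_div_mul_cancel hp.ne', rpow_one]
    linarith
  have hrp0 : 0 < r ^ p := rpow_pos_of_pos hr0 p
  set κ := ρ / r ^ p
  have hκ0 : 0 ≤ κ := by positivity
  have hκ1 : κ < 1 := (div_lt_one hrp0).2 hrp
  have hNp : ∫⁻ ω, ENNReal.ofReal ((M ω / r) ^ p) ∂μ = ENNReal.ofReal κ := by
    calc _ = ∫⁻ ω, ENNReal.ofReal (M ω ^ p) * ENNReal.ofReal ((r ^ p)⁻¹) ∂μ := by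
          refine lintegral_congr_ae ?_
          filter_upwards [hpos] with ω h
          rw [div_rpow h.le hr0.le, div_eq_mul_inv, ENNReal.ofReal_mul (rpow_nonneg h.le _)]
      _ = _ := by
          rw [lintegral_mul_const _ (by fun_prop), hρ, ← ENNReal.ofReal_mul hρ0,
            ← div_eq_mul_inv]
  set q := ∫⁻ ω, ENNReal.ofReal (|Q ω| ^ p) ∂μ
  set c := ENNReal.ofReal (((1 - r) ^ p)⁻¹) * q
  have hctop : c ≠ ⊤ := ENNReal.mul_ne_top ENNReal.ofReal_ne_top hQp
  set K := ENNReal.ofReal (1 / (1 - κ)) with hK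
  have hKeq : ENNReal.ofReal κ * K + 1 = K := by
    rw [hK, ← ENNReal.ofReal_mul hκ0, ← ENNReal.ofReal_one,
      ← ENNReal.ofReal_add (mul_nonneg hκ0 (by rw [one_div, inv_nonneg]; linarith)) zero_le_one]
    congr 1
    have : 1 - κ ≠ 0 := by linarith
    field_simp
    ring
  have hmain := le_of_renewal_inequality (μ := μ) (N := fun ω => M ω / r) (by fun_prop)
    (by filter_upwards [hpos] with ω h using div_pos h hr0) (p := p)
    (by rw [hNp]; exact ENNReal.ofReal_lt_one.2 hκ1)
    (T := fun v => ∫⁻ ω, ENNReal.ofReal (min 1 (v * |Y ω|) ^ p) ∂μ)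
    (G := fun v => K * c * ENNReal.ofReal (v ^ p))
    (g := fun v => c * ENNReal.ofReal (v ^ p)) ?_ ?_
    (fun ε hε => exists_lintegral_min_one_rpow_le hY hp hε)
  · have hbound : ∀ n : ℕ, ∫⁻ ω, ENNReal.ofReal (min ((n : ℝ) + 1) |Y ω| ^ p) ∂μ ≤ K * c := by
      intro n
      have hn : (0 : ℝ) < (n : ℝ) + 1 := by positivity
      have h := hmain (1 / ((n : ℝ) + 1)) (by positivity)
      calc _ = ∫⁻ ω, ENNReal.ofReal (((n : ℝ) + 1) ^ p) *
              ENNReal.ofReal (min 1 (1 / ((n : ℝ) + 1) * |Y ω|) ^ p) ∂μ := by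
            refine lintegral_congr fun ω => ?_
            rw [← ENNReal.ofReal_mul (by positivity), ← mul_rpow hn.le (by positivity),
              mul_min_of_nonneg _ _ hn.le, mul_one, ← mul_assoc, mul_one_div_cancel hn.ne', one_mul]
        _ = ENNReal.ofReal (((n : ℝ) + 1) ^ p) *
              ∫⁻ ω, ENNReal.ofReal (min 1 (1 / ((n : ℝ) + 1) * |Y ω|) ^ p) ∂μ :=
            lintegral_const_mul _ (by fun_prop)
        _ ≤ ENNReal.ofReal (((n : ℝ) + 1) ^ p) *
              (K * c * ENNReal.ofReal ((1 / ((n : ℝ) + 1)) ^ p)) := by gcongr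
        _ = K * c * ENNReal.ofReal (((n : ℝ) + 1) ^ p * (1 / ((n : ℝ) + 1)) ^ p) := by
            rw [ENNReal.ofReal_mul (by positivity)]; ring
        _ = K * c := by
            rw [← mul_rpow hn.le (by positivity), mul_one_div_cancel hn.ne', one_rpow,
              ENNReal.ofReal_one, mul_one]
    refine ne_top_of_le_ne_top (ENNReal.mul_ne_top ENNReal.ofReal_ne_top hctop) (b := K * c) ?_
    calc _ = ∫⁻ ω, liminf (fun n : ℕ => ENNReal.ofReal (min ((n : ℝ) + 1) |Y ω| ^ p)) atTop ∂μ := by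
          refine lintegral_congr fun ω => ?_
          refine (Tendsto.liminf_eq (tendsto_const_nhds.congr' ?_)).symm
          filter_upwards [eventually_ge_atTop ⌈|Y ω|⌉₊] with n hn
          rw [min_eq_right ((Nat.ceil_le.1 hn).trans (by linarith))]
      _ ≤ _ := lintegral_liminf_le fun n => by fun_prop
      _ ≤ K * c := liminf_le_of_le (by isBoundedDefault) fun b hb => by
          obtain ⟨n, hn⟩ := hb.exists
          exact hn.trans (hbound n)
  · intro v hv
    have h1r : 0 < 1 - r := by linarith
    calc ∫⁻ ω, ENNReal.ofReal (min 1 (v * |Y ω|) ^ p) ∂μ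
        = ∫⁻ ω, ENNReal.ofReal (min 1 (v * |Q ω + M ω * Y ω|) ^ p) ∂μ := by
          rw [← lintegral_map (f := fun y => ENNReal.ofReal (min 1 (v * |y|) ^ p)) (by fun_prop) hY,
            hlaw, lintegral_map (by fun_prop) (by fun_prop)]
      _ ≤ ∫⁻ ω, (ENNReal.ofReal (min 1 (v * (M ω / r) * |Y ω|) ^ p) +
            ENNReal.ofReal (((1 - r) ^ p)⁻¹) * ENNReal.ofReal (|Q ω| ^ p) *
              ENNReal.ofReal (v ^ p)) ∂μ := by
          refine lintegral_mono_ae ?_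
          filter_upwards [hpos] with ω hω
          rw [← ENNReal.ofReal_mul (by positivity), ← ENNReal.ofReal_mul (by positivity),
            ← ENNReal.ofReal_add (by positivity) (by positivity)]
          refine ENNReal.ofReal_le_ofReal ?_
          have hQeq : ((1 - r) ^ p)⁻¹ * |Q ω| ^ p * v ^ p = (v * |Q ω| / (1 - r)) ^ p := by
            rw [div_rpow (by positivity) h1r.le, mul_rpow hv.le (abs_nonneg _)]
            ring
          rw [hQeq]
          have habs : v * |Q ω + M ω * Y ω| ≤ v * |Q ω| + v * M ω * |Y ω| := by
            have := abs_add_le (Q ω) (M ω * Y ω)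
            rw [abs_mul, abs_of_pos hω] at this
            nlinarith
          rcases le_total (v * |Q ω|) ((1 - r) * (v * |Q ω + M ω * Y ω|)) with h | h
          · refine le_add_of_le_of_nonneg ?_ (by positivity)
            refine rpow_le_rpow (by positivity) (min_le_min_left 1 ?_) hp.le
            rw [mul_div_assoc', div_mul_eq_mul_div, le_div_iff₀ hr0]
            linarith
          · refine le_add_of_nonneg_of_le (by positivity) ?_
            refine rpow_le_rpow (by positivity) ((min_le_right _ _).trans ?_) hp.le
            rw [le_div_iff₀ h1r]
            linarith
      _ = _ := by
          rw [lintegral_add_right _ (by fun_prop), lintegral_mul_const _ (by fun_prop),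
            lintegral_const_mul _ (by fun_prop)]
          congr 1
          exact lintegral_of_indepFun
            (f := fun z : ℝ × ℝ × ℝ => ENNReal.ofReal (min 1 (v * (z.2.1 / r) * |z.1|) ^ p))
            hY (hM.prodMk hQ) hindep (by fun_prop)
  · intro v hv
    refine le_of_eq ?_
    calc ∫⁻ ω, K * c * ENNReal.ofReal ((v * (M ω / r)) ^ p) ∂μ + c * ENNReal.ofReal (v ^ p)
        = ∫⁻ ω, K * c * ENNReal.ofReal (v ^ p) * ENNReal.ofReal ((M ω / r) ^ p) ∂μ +
            c * ENNReal.ofReal (v ^ p) := by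
          congr 1
          refine lintegral_congr_ae ?_
          filter_upwards [hpos] with ω hω
          rw [mul_rpow hv.le (by positivity), ENNReal.ofReal_mul (by positivity), ← mul_assoc]
      _ = (ENNReal.ofReal κ * K + 1) * c * ENNReal.ofReal (v ^ p) := by
          rw [lintegral_const_mul _ (by fun_prop), hNp]
          ring
      _ = _ := by rw [hKeq]

/-- The piecewise linear function equal to `0` on `(-∞, 1/2]` and to `1` on `[1, ∞)`. -/
noncomputable def ramp (y : ℝ) : ℝ := max 0 (min 1 (2 * y - 1))

theorem measurable_ramp : Measurable ramp := by
  unfold ramp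
  fun_prop

theorem ramp_nonneg (y : ℝ) : 0 ≤ ramp y := le_max_left _ _

theorem ramp_eq_one {y : ℝ} (hy : 1 ≤ y) : ramp y = 1 := by
  rw [ramp, min_eq_left (by linarith), max_eq_right zero_le_one]

theorem ramp_le_min_one_rpow {y s : ℝ} (hy : 0 ≤ y) (hs1 : s ≤ 1) :
    ramp y ≤ min 1 y ^ s := by
  have h : ramp y ≤ min 1 y := by
    refine max_le (le_min zero_le_one hy) (le_min (min_le_left _ _) ?_)
    rcases le_total y 1 with h | h
    · exact (min_le_right _ _).trans (by linarith)
    · exact (min_le_left _ _).trans h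
  exact h.trans (self_le_rpow_of_le_one (le_min zero_le_one hy) (min_le_left _ _) hs1)

theorem ramp_le_ramp_add {a b x s : ℝ} (hx : 0 ≤ x) (hs : 0 ≤ s) (hs1 : s ≤ 1)
    (hab : a ≤ b + x) :
    ramp a ≤ ramp b + (2 * x) ^ s * (if 1 < 2 * (b + x) then 1 else 0) := by
  have h0 := ramp_nonneg b
  split_ifs with h
  · rw [mul_one]
    rcases le_total 1 (2 * x) with h1 | h1
    · have := one_le_rpow h1 hs
      have : ramp a ≤ 1 := max_le zero_le_one (min_le_left _ _)
      linarith
    · have h2 : 2 * x ≤ (2 * x) ^ s := self_le_rpow_of_le_one (by positivity) h1 hs1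
      refine max_le (by linarith) ?_
      rcases le_total 1 b with h3 | h3
      · rw [ramp_eq_one h3]
        exact (min_le_left _ _).trans (by linarith)
      · have : 2 * b - 1 ≤ ramp b := by
          rw [ramp, min_eq_right (by linarith)]
          exact le_max_right _ _
        exact (min_le_right _ _).trans (by linarith)
  · refine max_le (by linarith) ((min_le_right _ _).trans (by linarith))

theorem lintegral_min_rpow_le {Ω : Type*} [MeasurableSpace Ω] {μ : Measure Ω} {M : Ω → ℝ}
    (hM : Measurable M) (hpos : ∀ᵐ ω ∂μ, 0 < M ω) {s β ρ : ℝ}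
    (hρ : ∫⁻ ω, ENNReal.ofReal (M ω ^ s) ∂μ = ENNReal.ofReal ρ)
    (hβ : ∫⁻ ω, ENNReal.ofReal (M ω ^ β) ∂μ = 1) {v b : ℝ} (hv : 0 < v) (hb : 0 ≤ b) :
    ∫⁻ ω, ENNReal.ofReal (min ((v * M ω) ^ β * b) ((v * M ω) ^ s)) ∂μ ≤
      ENNReal.ofReal (min (v ^ β * b) (v ^ s * ρ)) := by
  rw [ENNReal.ofReal_min]
  refine le_min ?_ ?_
  · calc _ ≤ ∫⁻ ω, ENNReal.ofReal (v ^ β * b) * ENNReal.ofReal (M ω ^ β) ∂μ := by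
          refine lintegral_mono_ae ?_
          filter_upwards [hpos] with ω hω
          rw [← ENNReal.ofReal_mul (by positivity), mul_rpow hv.le hω.le]
          exact ENNReal.ofReal_le_ofReal ((min_le_left _ _).trans_eq (by ring))
      _ = _ := by rw [lintegral_const_mul _ (by fun_prop), hβ, mul_one]
  · calc _ ≤ ∫⁻ ω, ENNReal.ofReal (v ^ s) * ENNReal.ofReal (M ω ^ s) ∂μ := by
          refine lintegral_mono_ae ?_
          filter_upwards [hpos] with ω hω
          rw [← ENNReal.ofReal_mul (by positivity), ← mul_rpow hv.le hω.le]
          exact ENNReal.ofReal_le_ofReal (min_le_right _ _)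
      _ = _ := by
          rw [lintegral_const_mul _ (by fun_prop), hρ, ENNReal.ofReal_mul (by positivity)]

theorem rpow_mul_add_rpow_le {q m y s p : ℝ} (hq : 0 ≤ q) (hm : 0 ≤ m) (hy : 0 ≤ y) (hs : 0 < s)
    (hp : 0 < p) :
    q ^ s * (q + m * y) ^ p ≤ 2 ^ p * (q ^ (s + p) + (q ^ (s + p) + m ^ (s + p)) * y ^ p) := by
  have h1 : (q + m * y) ^ p ≤ 2 ^ p * (q ^ p + m ^ p * y ^ p) := by
    rw [← mul_rpow hm hy]
    rcases le_total q (m * y) with h | h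
    · calc (q + m * y) ^ p ≤ (2 * (m * y)) ^ p := by gcongr; linarith
        _ = 2 ^ p * (m * y) ^ p := mul_rpow (by norm_num) (by positivity)
        _ ≤ _ := by gcongr; exact le_add_of_nonneg_left (by positivity)
    · calc (q + m * y) ^ p ≤ (2 * q) ^ p := by gcongr; linarith
        _ = 2 ^ p * q ^ p := mul_rpow (by norm_num) (by positivity)
        _ ≤ _ := by gcongr; exact le_add_of_nonneg_right (by positivity)
  have h2 : q ^ s * m ^ p ≤ q ^ (s + p) + m ^ (s + p) := by
    rw [rpow_add_of_nonneg hq hs.le hp.le, rpow_add_of_nonneg hm hs.le hp.le]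
    rcases le_total q m with h | h
    · exact le_add_of_nonneg_of_le (by positivity) (by gcongr)
    · exact le_add_of_le_of_nonneg (by gcongr) (by positivity)
  calc q ^ s * (q + m * y) ^ p ≤ q ^ s * (2 ^ p * (q ^ p + m ^ p * y ^ p)) := by gcongr
    _ = 2 ^ p * (q ^ s * q ^ p + (q ^ s * m ^ p) * y ^ p) := by ring
    _ ≤ _ := by
      rw [← rpow_add_of_nonneg hq hs.le hp.le]
      gcongr

theorem lintegral_ramp_le {Ω : Type*} [MeasurableSpace Ω] {μ : Measure Ω}
    [IsProbabilityMeasure μ] {M Q Y : Ω → ℝ} (hM : Measurable M) (hQ : Measurable Q)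
    (hY : Measurable Y) (hpos : ∀ᵐ ω ∂μ, 0 < M ω) {s p : ℝ} (hs : 0 < s) (hs1 : s ≤ 1) (hp : 0 < p)
    {ρ : ℝ} (hρ0 : 0 ≤ ρ) (hρ1 : ρ < 1)
    (hρ : ∫⁻ ω, ENNReal.ofReal (M ω ^ s) ∂μ = ENNReal.ofReal ρ)
    (hβ : ∫⁻ ω, ENNReal.ofReal (M ω ^ (s + p)) ∂μ = 1)
    (hindep : IndepFun Y (fun ω => (M ω, Q ω)) μ)
    (hlaw : Measure.map Y μ = Measure.map (fun ω => Q ω + M ω * Y ω) μ) {v : ℝ} (hv : 0 < v) :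
    ∫⁻ ω, ENNReal.ofReal (ramp (v * |Y ω|)) ∂μ ≤
      ∫⁻ ω, ENNReal.ofReal (1 / (1 - ρ) * (2 * |Q ω|) ^ s *
        min (v ^ (s + p) * (2 * (|Q ω| + M ω * |Y ω|)) ^ p) (v ^ s)) ∂μ := by
  have hramp := measurable_ramp
  have hK : 0 ≤ 1 / (1 - ρ) := by rw [one_div, inv_nonneg]; linarith
  have hKρ : 1 / (1 - ρ) * ρ + 1 = 1 / (1 - ρ) := by
    have : 1 - ρ ≠ 0 := by linarith
    field_simp
    ring
  have hmeas : ∀ v : ℝ, MeasurableSet {ω | 1 < v * (2 * (|Q ω| + M ω * |Y ω|))} := fun v =>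
    measurableSet_lt measurable_const (by fun_prop)
  have hg : ∀ v : ℝ, Measurable fun ω => ENNReal.ofReal ((2 * |Q ω|) ^ s *
      (v ^ s * if 1 < v * (2 * (|Q ω| + M ω * |Y ω|)) then 1 else 0)) := fun v => by
    have : Measurable fun ω => if 1 < v * (2 * (|Q ω| + M ω * |Y ω|)) then (1 : ℝ) else 0 :=
      Measurable.ite (hmeas v) measurable_const measurable_const
    fun_prop
  refine le_of_renewal_inequality hM hpos (p := s)
    (by rw [hρ]; exact ENNReal.ofReal_lt_one.2 hρ1)
    (T := fun v => ∫⁻ ω, ENNReal.ofReal (ramp (v * |Y ω|)) ∂μ)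
    (G := fun v => ∫⁻ ω, ENNReal.ofReal (1 / (1 - ρ) * (2 * |Q ω|) ^ s *
        min (v ^ (s + p) * (2 * (|Q ω| + M ω * |Y ω|)) ^ p) (v ^ s)) ∂μ)
    (g := fun v => ∫⁻ ω, ENNReal.ofReal ((2 * |Q ω|) ^ s *
      (v ^ s * if 1 < v * (2 * (|Q ω| + M ω * |Y ω|)) then 1 else 0)) ∂μ) ?_ ?_ ?_ v hv
  · intro v hv
    calc ∫⁻ ω, ENNReal.ofReal (ramp (v * |Y ω|)) ∂μ
        = ∫⁻ ω, ENNReal.ofReal (ramp (v * |Q ω + M ω * Y ω|)) ∂μ := by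
          rw [← lintegral_map (f := fun y => ENNReal.ofReal (ramp (v * |y|))) (by fun_prop) hY,
            hlaw, lintegral_map (by fun_prop) (by fun_prop)]
      _ ≤ ∫⁻ ω, (ENNReal.ofReal (ramp (v * M ω * |Y ω|)) + ENNReal.ofReal ((2 * |Q ω|) ^ s *
            (v ^ s * if 1 < v * (2 * (|Q ω| + M ω * |Y ω|)) then 1 else 0))) ∂μ := by
          refine lintegral_mono_ae ?_
          filter_upwards [hpos] with ω hω
          have habs : v * |Q ω + M ω * Y ω| ≤ v * M ω * |Y ω| + v * |Q ω| := by
            have := abs_add_le (Q ω) (M ω * Y ω)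
            rw [abs_mul, abs_of_pos hω] at this
            nlinarith
          have h := ramp_le_ramp_add (by positivity) hs.le hs1 habs
          have e1 : 2 * (v * M ω * |Y ω| + v * |Q ω|) = v * (2 * (|Q ω| + M ω * |Y ω|)) := by ring
          have e2 : (2 * (v * |Q ω|)) ^ s = (2 * |Q ω|) ^ s * v ^ s := by
            rw [← mul_rpow (by positivity) hv.le]
            ring_nf
          rw [e1, e2, mul_assoc ((2 * |Q ω|) ^ s)] at h
          rw [← ENNReal.ofReal_add (ramp_nonneg _) (by positivity)]
          exact ENNReal.ofReal_le_ofReal h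
      _ = _ := by
          rw [lintegral_add_right _ (hg v)]
          congr 1
          exact lintegral_of_indepFun
            (f := fun z : ℝ × ℝ × ℝ => ENNReal.ofReal (ramp (v * z.2.1 * |z.1|)))
            hY (hM.prodMk hQ) hindep (by fun_prop)
  · intro v hv
    rw [lintegral_lintegral_swap (by unfold Function.uncurry; fun_prop),
      ← lintegral_add_right _ (hg v)]
    refine lintegral_mono_ae ?_
    filter_upwards [hpos] with ω hω
    have hc : 0 ≤ 1 / (1 - ρ) * (2 * |Q ω|) ^ s := by positivity
    set B := 2 * (|Q ω| + M ω * |Y ω|)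
    have hB0 : 0 ≤ B := by positivity
    calc _ = ENNReal.ofReal (1 / (1 - ρ) * (2 * |Q ω|) ^ s) *
            ∫⁻ ω', ENNReal.ofReal (min ((v * M ω') ^ (s + p) * B ^ p) ((v * M ω') ^ s)) ∂μ +
            ENNReal.ofReal ((2 * |Q ω|) ^ s * (v ^ s * if 1 < v * B then 1 else 0)) := by
          rw [← lintegral_const_mul _ (by fun_prop)]
          simp only [ENNReal.ofReal_mul hc]
      _ ≤ ENNReal.ofReal (1 / (1 - ρ) * (2 * |Q ω|) ^ s) *
            ENNReal.ofReal (min (v ^ (s + p) * B ^ p) (v ^ s * ρ)) +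
            ENNReal.ofReal ((2 * |Q ω|) ^ s * (v ^ s * if 1 < v * B then 1 else 0)) := by
          gcongr
          exact lintegral_min_rpow_le hM hpos hρ hβ hv (by positivity)
      _ ≤ _ := by
          rw [← ENNReal.ofReal_mul hc, ← ENNReal.ofReal_add (by positivity) (by positivity)]
          refine ENNReal.ofReal_le_ofReal ?_
          split_ifs with h
          · have hBp : v ^ s ≤ v ^ (s + p) * B ^ p := by
              rw [rpow_add hv, mul_assoc, ← mul_rpow hv.le hB0]
              exact le_mul_of_one_le_right (by positivity) (one_le_rpow h.le hp.le)
            rw [min_eq_right hBp, min_eq_right ((mul_le_of_le_one_right (by positivity)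
              hρ1.le).trans hBp)]
            refine le_of_eq ?_
            linear_combination (2 * |Q ω|) ^ s * v ^ s * hKρ
          · rw [mul_zero, mul_zero, add_zero]
            gcongr
            exact mul_le_of_le_one_right (by positivity) hρ1.le
  · intro ε hε
    obtain ⟨A, hA⟩ := exists_lintegral_min_one_rpow_le (μ := μ) hY hs hε
    exact ⟨A, fun v hv => (lintegral_mono fun ω => ENNReal.ofReal_le_ofReal
      (ramp_le_min_one_rpow (by positivity) hs1)).trans (hA v hv)⟩

theorem lintegral_rpow_mul_rpow_ne_top {Ω : Type*} [MeasurableSpace Ω] {μ : Measure Ω}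
    [IsProbabilityMeasure μ] {M Q Y : Ω → ℝ} (hM : Measurable M) (hQ : Measurable Q)
    (hY : Measurable Y) (hpos : ∀ᵐ ω ∂μ, 0 < M ω) {s p : ℝ} (hs : 0 < s) (hp : 0 < p)
    (hMβ : ∫⁻ ω, ENNReal.ofReal (M ω ^ (s + p)) ∂μ ≠ ⊤)
    (hQβ : ∫⁻ ω, ENNReal.ofReal (|Q ω| ^ (s + p)) ∂μ ≠ ⊤)
    (hYp : ∫⁻ ω, ENNReal.ofReal (|Y ω| ^ p) ∂μ ≠ ⊤)
    (hindep : IndepFun Y (fun ω => (M ω, Q ω)) μ) :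
    ∫⁻ ω, ENNReal.ofReal (|Q ω| ^ s * (|Q ω| + M ω * |Y ω|) ^ p) ∂μ ≠ ⊤ := by
  have hprod : ∫⁻ ω, (ENNReal.ofReal (|Q ω| ^ (s + p)) + ENNReal.ofReal (M ω ^ (s + p))) *
      ENNReal.ofReal (|Y ω| ^ p) ∂μ =
      (∫⁻ ω, (ENNReal.ofReal (|Q ω| ^ (s + p)) + ENNReal.ofReal (M ω ^ (s + p))) ∂μ) *
        ∫⁻ ω, ENNReal.ofReal (|Y ω| ^ p) ∂μ :=
    lintegral_mul_eq_lintegral_mul_lintegral_of_indepFun (by fun_prop) (by fun_prop)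
      (hindep.symm.comp
        (φ := fun z : ℝ × ℝ => ENNReal.ofReal (|z.2| ^ (s + p)) + ENNReal.ofReal (z.1 ^ (s + p)))
        (ψ := fun y : ℝ => ENNReal.ofReal (|y| ^ p)) (by fun_prop) (by fun_prop))
  refine ne_top_of_le_ne_top (b := ENNReal.ofReal (2 ^ p) *
    (∫⁻ ω, ENNReal.ofReal (|Q ω| ^ (s + p)) ∂μ + (∫⁻ ω, ENNReal.ofReal (|Q ω| ^ (s + p)) ∂μ +
      ∫⁻ ω, ENNReal.ofReal (M ω ^ (s + p)) ∂μ) * ∫⁻ ω, ENNReal.ofReal (|Y ω| ^ p) ∂μ))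
    (by finiteness) ?_
  rw [← lintegral_add_right _ (by fun_prop), ← hprod, ← lintegral_add_right _ (by fun_prop),
    ← lintegral_const_mul _ (by fun_prop)]
  refine lintegral_mono_ae ?_
  filter_upwards [hpos] with ω hω
  rw [← ENNReal.ofReal_add (by positivity) (by positivity), ← ENNReal.ofReal_mul (by positivity),
    ← ENNReal.ofReal_add (by positivity) (by positivity), ← ENNReal.ofReal_mul (by positivity)]
  exact ENNReal.ofReal_le_ofReal
    (rpow_mul_add_rpow_le (abs_nonneg _) hω.le (abs_nonneg _) hs hp)

/-- **Grincevičius-type theorem, arithmetic case.** If `Y` is independent of `(M, Q)`, solves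
the distributional equation `Y =d Q + M * Y`, the law of `log M` is concentrated on the lattice
`dℤ` for some `d > 0`, and for some `β > 0` one has `E[M^β] = 1`, `E[M^β (log M)⁺] < ∞` and
`E[|Q|^β] < ∞`, then `limsup_{u→∞} u^β * P(Y > u) < ∞`. -/
theorem grincevicius_arithmetic
    {Ω : Type*} [MeasurableSpace Ω] (μ : Measure Ω) [IsProbabilityMeasure μ]
    (M Q Y : Ω → ℝ) (hMmeas : Measurable M) (hQmeas : Measurable Q) (hYmeas : Measurable Y)
    (hMpos : ∀ᵐ ω ∂μ, 0 < M ω)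
    (hMne1 : 0 < μ {ω | M ω ≠ 1})
    (d : ℝ) (hd : 0 < d)
    (harith : ∀ᵐ ω ∂μ, ∃ k : ℤ, Real.log (M ω) = k * d)
    (β : ℝ) (hβ : 0 < β)
    (hMβint : Integrable (fun ω => M ω ^ β) μ)
    (hMβ : ∫ ω, M ω ^ β ∂μ = 1)
    (hMlog : Integrable (fun ω => M ω ^ β * max (Real.log (M ω)) 0) μ)
    (hQβ : Integrable (fun ω => |Q ω| ^ β) μ)
    (hindep : IndepFun Y (fun ω => (M ω, Q ω)) μ)
    (hlaw : Measure.map Y μ = Measure.map (fun ω => Q ω + M ω * Y ω) μ) :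
    IsBoundedUnder (· ≤ ·) atTop (fun u : ℝ => u ^ β * (μ {ω | Y ω > u}).toReal) := by
  obtain ⟨s, hs, hs1, hsβ⟩ : ∃ s : ℝ, 0 < s ∧ s ≤ 1 ∧ s < β :=
    ⟨min 1 (β / 2), lt_min one_pos (by positivity), min_le_left _ _,
      (min_le_right _ _).trans_lt (by linarith)⟩
  obtain ⟨p, rfl⟩ : ∃ p, β = s + p := ⟨β - s, by ring⟩
  have hp : 0 < p := by linarith
  obtain ⟨ρ, hρ0, hρ1, hρ⟩ :=
    exists_lintegral_rpow_eq_lt_one hMmeas hMpos hMne1 hs hsβ hMβint hMβ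
  obtain ⟨τ, hτ0, hτ1, hτ⟩ :=
    exists_lintegral_rpow_eq_lt_one hMmeas hMpos hMne1 hp (by linarith) hMβint hMβ
  have hMβ' : ∫⁻ ω, ENNReal.ofReal (M ω ^ (s + p)) ∂μ = 1 := by
    rw [← ofReal_integral_eq_lintegral_ofReal hMβint
      (by filter_upwards [hMpos] with ω h using rpow_nonneg h.le _), hMβ, ENNReal.ofReal_one]
  have hQβ' : ∫⁻ ω, ENNReal.ofReal (|Q ω| ^ (s + p)) ∂μ ≠ ⊤ := by
    rw [← ofReal_integral_eq_lintegral_ofReal hQβ (ae_of_all _ fun ω => by positivity)]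
    exact ENNReal.ofReal_ne_top
  have hQp : ∫⁻ ω, ENNReal.ofReal (|Q ω| ^ p) ∂μ ≠ ⊤ := by
    refine ne_top_of_le_ne_top (b := ∫⁻ ω, (1 + ENNReal.ofReal (|Q ω| ^ (s + p))) ∂μ) ?_
      (lintegral_mono fun ω => ?_)
    · rw [lintegral_add_right _ (by fun_prop)]
      simpa using hQβ'
    · rcases le_total |Q ω| 1 with h | h
      · refine le_add_right (ENNReal.ofReal_le_one.2 (rpow_le_one (abs_nonneg _) h hp.le))
      · refine le_add_left (ENNReal.ofReal_le_ofReal ?_)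
        exact rpow_le_rpow_of_exponent_le h (by linarith)
  have hYp := lintegral_abs_rpow_ne_top_of_map_eq hMmeas hQmeas hYmeas hMpos hp hτ0 hτ1 hτ hQp
    hindep hlaw
  have hfin := lintegral_rpow_mul_rpow_ne_top hMmeas hQmeas hYmeas hMpos hs hp
    (by rw [hMβ']; exact ENNReal.one_ne_top) hQβ' hYp hindep
  set E := ∫⁻ ω, ENNReal.ofReal (|Q ω| ^ s * (|Q ω| + M ω * |Y ω|) ^ p) ∂μ
  have hK : 0 ≤ 1 / (1 - ρ) := by rw [one_div, inv_nonneg]; linarith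
  have htail : ∀ u > 0, μ {ω | Y ω > u} ≤
      ENNReal.ofReal (1 / (1 - ρ) * (2 ^ s * 2 ^ p) * u⁻¹ ^ (s + p)) * E := by
    intro u hu
    have hu' : 0 < u⁻¹ := inv_pos.2 hu
    calc μ {ω | Y ω > u} = ∫⁻ ω, {ω | Y ω > u}.indicator 1 ω ∂μ :=
          (lintegral_indicator_one (measurableSet_lt measurable_const hYmeas)).symm
      _ ≤ ∫⁻ ω, ENNReal.ofReal (ramp (u⁻¹ * |Y ω|)) ∂μ := by
          refine lintegral_mono fun ω => Set.indicator_le'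
            (g := fun ω => ENNReal.ofReal (ramp (u⁻¹ * |Y ω|))) (fun ω h => ?_)
            (fun _ _ => zero_le) ω
          rw [ramp_eq_one, ENNReal.ofReal_one, Pi.one_apply]
          rw [inv_mul_eq_div, one_le_div hu]
          exact (le_of_lt h).trans (le_abs_self _)
      _ ≤ _ := lintegral_ramp_le hMmeas hQmeas hYmeas hMpos hs hs1 hp hρ0 hρ1 hρ hMβ' hindep hlaw
          hu'
      _ ≤ ∫⁻ ω, ENNReal.ofReal (1 / (1 - ρ) * (2 ^ s * 2 ^ p) * u⁻¹ ^ (s + p)) *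
            ENNReal.ofReal (|Q ω| ^ s * (|Q ω| + M ω * |Y ω|) ^ p) ∂μ := by
          refine lintegral_mono_ae ?_
          filter_upwards [hMpos] with ω hω
          rw [← ENNReal.ofReal_mul (by positivity)]
          refine ENNReal.ofReal_le_ofReal ?_
          rw [mul_rpow two_pos.le (abs_nonneg (Q ω)), mul_rpow two_pos.le (by positivity)]
          calc _ ≤ 1 / (1 - ρ) * (2 ^ s * |Q ω| ^ s) *
                (u⁻¹ ^ (s + p) * (2 ^ p * (|Q ω| + M ω * |Y ω|) ^ p)) := by
                gcongr
                exact min_le_left _ _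
            _ = _ := by ring
      _ = _ := lintegral_const_mul _ (by fun_prop)
  refine isBoundedUnder_of_eventually_le
    (a := 1 / (1 - ρ) * (2 ^ s * 2 ^ p) * E.toReal) ?_
  filter_upwards [eventually_gt_atTop 0] with u hu
  have h := ENNReal.toReal_mono (ENNReal.mul_ne_top ENNReal.ofReal_ne_top hfin) (htail u hu)
  rw [ENNReal.toReal_mul, ENNReal.toReal_ofReal (by positivity)] at h
  calc u ^ (s + p) * (μ {ω | Y ω > u}).toReal
      ≤ u ^ (s + p) * (1 / (1 - ρ) * (2 ^ s * 2 ^ p) * u⁻¹ ^ (s + p) * E.toReal) := by gcongr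
    _ = (u ^ (s + p) * u⁻¹ ^ (s + p)) * (1 / (1 - ρ) * (2 ^ s * 2 ^ p) * E.toReal) := by ring
    _ = _ := by
      rw [← mul_rpow hu.le (by positivity), mul_inv_cancel₀ hu.ne', one_rpow, one_mul]
end

section
/- Let (M,Q) be a two-dimensional random vector with M>0 almost surely and P(M≠1)>0, and suppose there exists β>0 such that E[M^β]=1, E[M^β (ln M)⁺]<∞ and E[|Q|^β]<∞. Let Y_∞ be a random variable independent of (M,Q) whose law equals the law of Q+M·Y_∞. If the support of the law of Y_∞ is unbounded from above (i.e. P(Y_∞>u)>0 for every u∈ℝ), then liminf_{u→∞} u^β P(Y_∞>u) > 0. (Guivarc'h–Le Page/Buraczewski–Damek positivity criterion.) -/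
open MeasureTheory ProbabilityTheory Filter Real

open scoped Topology

section Elementary

/-- Tangent line inequality for the convex function `t ↦ log (1 + d * exp (-t))`, written in the
variable `u = exp t`. -/
lemma mul_log_sub_log_le_log_one_add_div_sub {d u v : ℝ} (hd : 0 ≤ d) (hu : 0 < u) (hv : 0 < v) :
    d / (d + u) * (log u - log v) ≤ log (1 + d / v) - log (1 + d / u) := by
  have hdu : 0 < d + u := by linarith
  have hconc := strictConcaveOn_log_Ioi.concaveOn.2 (Set.mem_Ioi.2 one_pos)
    (Set.mem_Ioi.2 (div_pos hu hv)) (show 0 ≤ u / (d + u) by positivity)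
    (show 0 ≤ d / (d + u) by positivity) (by field_simp; ring)
  simp only [smul_eq_mul, log_one, mul_zero, zero_add, mul_one] at hconc
  rw [log_div hu.ne' hv.ne'] at hconc
  refine hconc.trans_eq ?_
  rw [← log_div (by positivity) (by positivity)]
  congr 1
  field_simp
  ring

lemma one_sub_mul_div_le_div_rpow {β b u : ℝ} (hβ : 0 < β) (hb : 0 ≤ b) (hu : 0 < u) :
    1 - (β + 1) * (b / (b + u)) ≤ (u / (u + b)) ^ β := by
  have hz0 : 0 ≤ b / (b + u) := by positivity
  have hz1 : b / (b + u) ≤ 1 := (div_le_one (by positivity)).2 (by linarith)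
  have hx : u / (u + b) = 1 + -(b / (b + u)) := by field_simp; ring
  rcases le_total 1 β with h | h
  · have := one_add_mul_self_le_rpow_one_add (s := -(b / (b + u))) (by linarith) h
    rw [hx]
    nlinarith
  · have h1 : u / (u + b) ≤ (u / (u + b)) ^ β :=
      self_le_rpow_of_le_one (by positivity) (by rw [hx]; linarith) h
    nlinarith

/-- One step of the affine recursion applied to a truncated power function: the loss with respect
to the multiplicative recursion is controlled by `(m + b) / (m + b + u)`. -/
lemma rpow_mul_sub_le_mul_ite {β m b u p : ℝ} (hβ : 0 < β) (hm : 0 < m) (hb : 0 ≤ b) (hu : 0 < u)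
    (hp : 0 ≤ p) (hp2 : p ≤ 2) :
    m ^ β * (p - 2 * (β + 3) * ((m + b) / (m + b + u))) ≤
      u ^ β * (if 1 < (u + b) / m then ((u + b) / m) ^ (-β) * p else 0) := by
  have hbd : b / (b + u) ≤ (m + b) / (m + b + u) := by
    rw [div_le_div_iff₀ (by positivity) (by positivity)]; nlinarith
  have hd0 : 0 ≤ b / (b + u) := by positivity
  have hW : 0 < m ^ β := rpow_pos_of_pos hm β
  split_ifs with h
  · have hpow : u ^ β * (((u + b) / m) ^ (-β) * p) = m ^ β * ((u / (u + b)) ^ β * p) := by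
      rw [rpow_neg (by positivity), ← inv_rpow (by positivity), inv_div,
        div_rpow hm.le (by positivity), div_rpow hu.le (by positivity)]
      ring
    rw [hpow]
    refine mul_le_mul_of_nonneg_left ?_ hW.le
    have h1 := mul_le_mul_of_nonneg_right (one_sub_mul_div_le_div_rpow hβ hb hu) hp
    have h2 : p * ((β + 1) * (b / (b + u))) ≤ 2 * ((β + 1) * (b / (b + u))) :=
      mul_le_mul_of_nonneg_right hp2 (by positivity)
    have h3 : (β + 1) * (b / (b + u)) ≤ (β + 3) * ((m + b) / (m + b + u)) :=
      mul_le_mul (by linarith) hbd hd0 (by positivity)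
    linarith
  · rw [mul_zero]
    refine mul_nonpos_of_nonneg_of_nonpos hW.le ?_
    have hle : u + b ≤ m := by rwa [not_lt, div_le_one hm] at h
    have : 1 / 2 ≤ (m + b) / (m + b + u) := by
      rw [div_le_div_iff₀ (by positivity) (by positivity)]; linarith
    nlinarith

lemma rpow_mul_log_one_add_le {β m b : ℝ} (hβ : 0 < β) (hm : 0 < m) (hb : 0 ≤ b) :
    m ^ β * log (1 + b) ≤
      2 * (m ^ β * max (log m) 0) + 2 / β * (2 ^ β * (1 + b ^ β)) := by
  have hW : 0 < m ^ β := rpow_pos_of_pos hm β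
  have hmax : max (log m) 0 = log (max m 1) := by
    rcases le_total 1 m with h | h
    · rw [max_eq_left h, max_eq_left (log_nonneg h)]
    · rw [max_eq_right h, max_eq_right (log_nonpos hm.le h), log_one]
  have hm1 : 0 < max m 1 := lt_max_of_lt_left hm
  have hbβ : 0 ≤ b ^ β := rpow_nonneg hb β
  rcases le_total (1 + b) (max m 1 ^ 2) with h | h
  · have h1 : log (1 + b) ≤ 2 * max (log m) 0 := by
      rw [hmax]
      calc log (1 + b) ≤ log (max m 1 ^ 2) := log_le_log (by positivity) h
        _ = _ := by rw [log_pow]; norm_num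
    have : 0 ≤ 2 / β * (2 ^ β * (1 + b ^ β)) := by positivity
    nlinarith
  · have h1 : m ^ β ≤ (1 + b) ^ (β / 2) := by
      calc m ^ β ≤ max m 1 ^ β := rpow_le_rpow hm.le (le_max_left _ _) hβ.le
        _ = (max m 1 ^ 2) ^ (β / 2) := by
          rw [← rpow_natCast, ← rpow_mul hm1.le]; congr 1; push_cast; ring
        _ ≤ _ := rpow_le_rpow (by positivity) h (by positivity)
    have h2 : log (1 + b) ≤ (1 + b) ^ (β / 2) / (β / 2) :=
      log_le_rpow_div (by positivity) (by positivity)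
    have h3 : (1 + b) ^ β ≤ 2 ^ β * (1 + b ^ β) := by
      rcases le_total b 1 with hb1 | hb1
      · have : (1 + b) ^ β ≤ 2 ^ β := rpow_le_rpow (by positivity) (by linarith) hβ.le
        have h2p : (0 : ℝ) < 2 ^ β := by positivity
        nlinarith
      · have : (1 + b) ^ β ≤ (2 * b) ^ β := rpow_le_rpow (by positivity) (by linarith) hβ.le
        rw [mul_rpow (by norm_num) hb] at this
        have h2p : (0 : ℝ) < 2 ^ β := by positivity
        nlinarith
    have h4 : m ^ β * log (1 + b) ≤ (1 + b) ^ (β / 2) * ((1 + b) ^ (β / 2) / (β / 2)) :=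
      mul_le_mul h1 h2 (log_nonneg (by linarith)) (by positivity)
    have h5 : (1 + b) ^ (β / 2) * ((1 + b) ^ (β / 2) / (β / 2)) = 2 / β * (1 + b) ^ β := by
      rw [← mul_div_assoc, ← rpow_add (by positivity), add_halves]; field_simp
    have h6 : 2 / β * (1 + b) ^ β ≤ 2 / β * (2 ^ β * (1 + b ^ β)) :=
      mul_le_mul_of_nonneg_left h3 (by positivity)
    have h7 : 0 ≤ 2 * (m ^ β * max (log m) 0) := by positivity
    linarith

lemma abs_rpow_mul_log_le {β m : ℝ} (hβ : 0 < β) (hm : 0 < m) :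
    |m ^ β * log m| ≤ m ^ β * max (log m) 0 + 1 / β := by
  have hW : 0 < m ^ β := rpow_pos_of_pos hm β
  rcases le_total 0 (log m) with h | h
  · rw [max_eq_left h, abs_of_nonneg (by positivity)]
    have : 0 < 1 / β := by positivity
    linarith
  · rw [max_eq_right h, mul_zero, zero_add, abs_of_nonpos (by nlinarith)]
    have h1 := log_le_rpow_div (x := m⁻¹) (by positivity) hβ
    rw [log_inv, inv_rpow hm.le] at h1
    calc -(m ^ β * log m) = m ^ β * -log m := by ring
      _ ≤ m ^ β * ((m ^ β)⁻¹ / β) := mul_le_mul_of_nonneg_left h1 hW.le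
      _ = 1 / β := by field_simp

end Elementary

section LogPotential

variable {Ω : Type*} [MeasurableSpace Ω]

/-- The integral of `log (1 + D / u)` against the measure with density `W`. -/
noncomputable def logPotential (μ : Measure Ω) (W D : Ω → ℝ) (u : ℝ) : ℝ :=
  ∫ ω, W ω * log (1 + D ω / u) ∂μ

variable {μ : Measure Ω} {W D : Ω → ℝ}

lemma log_one_add_div_le {d u : ℝ} (hd : 0 ≤ d) (hu : 1 ≤ u) : log (1 + d / u) ≤ log (1 + d) := by
  have := div_le_self hd hu
  exact log_le_log (by positivity) (by linarith)

lemma norm_mul_log_one_add_div_le {w d u : ℝ} (hw : 0 ≤ w) (hd : 0 ≤ d) (hu : 1 ≤ u) :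
    ‖w * log (1 + d / u)‖ ≤ w * log (1 + d) := by
  have : 0 ≤ log (1 + d / u) := log_nonneg (by have : 0 ≤ d / u := by positivity
                                               linarith)
  rw [norm_of_nonneg (by positivity)]
  exact mul_le_mul_of_nonneg_left (log_one_add_div_le hd hu) hw

lemma integrable_mul_log_one_add_div (hWm : Measurable W) (hDm : Measurable D)
    (hW : ∀ ω, 0 ≤ W ω) (hD : ∀ ω, 0 ≤ D ω)
    (hWD : Integrable (fun ω => W ω * log (1 + D ω)) μ) {u : ℝ} (hu : 1 ≤ u) :
    Integrable (fun ω => W ω * log (1 + D ω / u)) μ :=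
  hWD.mono' (by fun_prop)
    (Eventually.of_forall fun ω => norm_mul_log_one_add_div_le (hW ω) (hD ω) hu)

lemma logPotential_nonneg (hW : ∀ ω, 0 ≤ W ω) (hD : ∀ ω, 0 ≤ D ω) {u : ℝ} (hu : 1 ≤ u) :
    0 ≤ logPotential μ W D u :=
  integral_nonneg fun ω => mul_nonneg (hW ω) <| log_nonneg <| by
    have : 0 ≤ D ω / u := div_nonneg (hD ω) (by linarith)
    linarith

lemma integrable_mul_div_add (hWm : Measurable W) (hDm : Measurable D)
    (hW : ∀ ω, 0 ≤ W ω) (hD : ∀ ω, 0 ≤ D ω) (hWi : Integrable W μ) {u : ℝ} (hu : 0 < u) :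
    Integrable (fun ω => W ω * (D ω / (D ω + u))) μ := by
  refine hWi.mono' (by fun_prop) (Eventually.of_forall fun ω => ?_)
  have h0 : 0 ≤ D ω / (D ω + u) := div_nonneg (hD ω) (by linarith [hD ω])
  have h1 : D ω / (D ω + u) ≤ 1 := (div_le_one (by linarith [hD ω])).2 (by linarith)
  rw [norm_of_nonneg (mul_nonneg (hW ω) h0)]
  exact mul_le_of_le_one_right (hW ω) h1

lemma integral_mul_div_add_mul_le_logPotential_sub (hWm : Measurable W) (hDm : Measurable D)
    (hW : ∀ ω, 0 ≤ W ω) (hD : ∀ ω, 0 ≤ D ω) (hWi : Integrable W μ)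
    (hWD : Integrable (fun ω => W ω * log (1 + D ω)) μ) {u v : ℝ} (hu : 1 ≤ u) (hv : 1 ≤ v) :
    (∫ ω, W ω * (D ω / (D ω + u)) ∂μ) * (log u - log v) ≤
      logPotential μ W D v - logPotential μ W D u := by
  have hIu := integrable_mul_log_one_add_div hWm hDm hW hD hWD hu
  have hIv := integrable_mul_log_one_add_div hWm hDm hW hD hWD hv
  rw [logPotential, logPotential, ← integral_sub hIv hIu, ← integral_mul_const]
  refine integral_mono
    ((integrable_mul_div_add hWm hDm hW hD hWi (by linarith)).mul_const _) (hIv.sub hIu) fun ω => ?_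
  have := mul_le_mul_of_nonneg_left (mul_log_sub_log_le_log_one_add_div_sub (hD ω)
    (show 0 < u by linarith) (show 0 < v by linarith)) (hW ω)
  simp only
  linarith

lemma logPotential_antitone (hWm : Measurable W) (hDm : Measurable D)
    (hW : ∀ ω, 0 ≤ W ω) (hD : ∀ ω, 0 ≤ D ω)
    (hWD : Integrable (fun ω => W ω * log (1 + D ω)) μ) :
    AntitoneOn (logPotential μ W D) (Set.Ici 1) := by
  intro u hu v hv huv
  rw [Set.mem_Ici] at hu hv
  refine integral_mono (integrable_mul_log_one_add_div hWm hDm hW hD hWD hv)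
    (integrable_mul_log_one_add_div hWm hDm hW hD hWD hu) fun ω => ?_
  have h1 : D ω / v ≤ D ω / u := div_le_div_of_nonneg_left (hD ω) (by linarith) huv
  have h0 : 0 ≤ D ω / v := div_nonneg (hD ω) (by linarith)
  exact mul_le_mul_of_nonneg_left (log_le_log (by linarith) (by linarith)) (hW ω)

lemma tendsto_logPotential_atTop (hWm : Measurable W) (hDm : Measurable D)
    (hW : ∀ ω, 0 ≤ W ω) (hD : ∀ ω, 0 ≤ D ω)
    (hWD : Integrable (fun ω => W ω * log (1 + D ω)) μ) :
    Tendsto (logPotential μ W D) atTop (𝓝 0) := by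
  rw [← integral_zero Ω ℝ (μ := μ)]
  refine tendsto_integral_filter_of_dominated_convergence _
    (Eventually.of_forall fun u => by fun_prop) ?_ hWD (Eventually.of_forall fun ω => ?_)
  · filter_upwards [eventually_ge_atTop 1] with u hu
    exact Eventually.of_forall fun ω => norm_mul_log_one_add_div_le (hW ω) (hD ω) hu
  · have h1 : Tendsto (fun u : ℝ => 1 + D ω / u) atTop (𝓝 (1 + 0)) :=
      (tendsto_const_nhds.div_atTop tendsto_id).const_add 1
    have h2 := ((continuousAt_log (x := 1 + 0) (by norm_num)).tendsto.comp h1).const_mul (W ω)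
    simpa using h2

lemma continuousOn_logPotential (hWm : Measurable W) (hDm : Measurable D)
    (hW : ∀ ω, 0 ≤ W ω) (hD : ∀ ω, 0 ≤ D ω)
    (hWD : Integrable (fun ω => W ω * log (1 + D ω)) μ) :
    ContinuousOn (logPotential μ W D) (Set.Ici 1) := by
  refine continuousOn_of_dominated (fun u _ => by fun_prop)
    (fun u hu => Eventually.of_forall fun ω => norm_mul_log_one_add_div_le (hW ω) (hD ω) hu) hWD
    (Eventually.of_forall fun ω => ?_)
  have hpos : ∀ u ∈ Set.Ici (1 : ℝ), 0 < u := fun u hu => lt_of_lt_of_le one_pos hu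
  refine continuousOn_const.mul (ContinuousOn.log ?_ fun u hu => ?_)
  · exact continuousOn_const.add (continuousOn_const.div continuousOn_id fun u hu => (hpos u hu).ne')
  · have := div_nonneg (hD ω) (hpos u hu).le
    positivity

end LogPotential

section Comparison

/-- Comparison principle: a strict subsolution vanishing at infinity that lies below a
nonnegative supersolution on `(-∞, a]` lies below it everywhere. -/
lemma le_of_strict_subsolution {Ω : Type*} [MeasurableSpace Ω] {μ : Measure Ω}
    [IsProbabilityMeasure μ] {T : ℝ → Ω → ℝ} {F g : ℝ → ℝ} {a : ℝ}
    (hF : LowerSemicontinuous F) (hF0 : ∀ u, 0 ≤ F u)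
    (hgc : ContinuousOn g (Set.Ici a)) (hg0 : Tendsto g atTop (𝓝 0))
    (hle : ∀ u ≤ a, g u ≤ F u)
    (hFi : ∀ u ≥ a, Integrable (fun ω => F (T u ω)) μ)
    (hgi : ∀ u ≥ a, Integrable (fun ω => g (T u ω)) μ)
    (hFT : ∀ u ≥ a, ∫ ω, F (T u ω) ∂μ ≤ F u)
    (hgT : ∀ u ≥ a, g u < ∫ ω, g (T u ω) ∂μ) (u : ℝ) : g u ≤ F u := by
  by_contra! hu
  have hau : a < u := by
    by_contra! h
    exact absurd (hle u h) hu.not_ge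
  obtain ⟨R, hR⟩ := (hg0.eventually (gt_mem_nhds (sub_pos.2 hu))).exists_forall_of_atTop
  have huR : u < R := by
    by_contra! h
    have := hR u h
    linarith [hF0 u]
  have husc : UpperSemicontinuousOn (fun v => g v + -F v) (Set.Icc a R) := by
    refine UpperSemicontinuousOn.add
      (hgc.mono Set.Icc_subset_Ici_self).upperSemicontinuousOn fun v _ y hy => ?_
    have := hF v (-y) (by simpa using neg_lt_neg hy)
    exact (this.filter_mono nhdsWithin_le_nhds).mono fun w hw => by linarith
  obtain ⟨z, hz, hzmax⟩ :=
    husc.exists_isMaxOn (Set.nonempty_Icc.2 (hau.trans huR).le) isCompact_Icc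
  have hzu : g u - F u ≤ g z - F z := by
    simpa [sub_eq_add_neg] using hzmax (Set.mem_Icc.2 ⟨hau.le, huR.le⟩)
  have hall : ∀ v, g v - F v ≤ g z - F z := fun v => by
    rcases le_total v a with hva | hva
    · linarith [hle v hva]
    rcases le_total v R with hvR | hvR
    · simpa [sub_eq_add_neg] using hzmax (Set.mem_Icc.2 ⟨hva, hvR⟩)
    · linarith [hR v hvR, hF0 v]
  have hint : ∫ ω, (g (T z ω) - F (T z ω)) ∂μ ≤ g z - F z := by
    calc _ ≤ ∫ _, (g z - F z) ∂μ :=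
          integral_mono ((hgi z hz.1).sub (hFi z hz.1)) (integrable_const _) fun ω => hall _
      _ = _ := by simp
  rw [integral_sub (hgi z hz.1) (hFi z hz.1)] at hint
  linarith [hFT z hz.1, hgT z hz.1]

end Comparison

section Tail

variable {Ω : Type*} [MeasurableSpace Ω] {μ : Measure Ω} [IsProbabilityMeasure μ]

lemma antitone_tail (Y : Ω → ℝ) : Antitone fun u => (μ {ω | Y ω > u}).toReal :=
  fun _ _ h => ENNReal.toReal_mono (measure_ne_top _ _)
    (measure_mono fun _ hω => lt_of_le_of_lt h hω)

lemma lowerSemicontinuous_tail {Y : Ω → ℝ} :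
    LowerSemicontinuous fun u => (μ {ω | Y ω > u}).toReal := by
  intro u y hy
  have hunion : ⋃ n : ℕ, {ω | Y ω > u + 1 / ((n : ℝ) + 1)} = {ω | Y ω > u} := by
    ext ω
    simp only [Set.mem_iUnion, Set.mem_ofPred_eq, gt_iff_lt]
    refine ⟨fun ⟨n, hn⟩ => lt_trans (by simpa using Nat.one_div_pos_of_nat (α := ℝ)) hn,
      fun h => ?_⟩
    obtain ⟨n, hn⟩ := exists_nat_one_div_lt (sub_pos.2 h)
    exact ⟨n, by linarith⟩
  have hmono : Monotone fun n : ℕ => {ω | Y ω > u + 1 / ((n : ℝ) + 1)} := fun m n hmn ω hω =>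
    lt_of_le_of_lt (add_le_add_right (Nat.one_div_le_one_div hmn) u) hω
  have hlim := tendsto_measure_iUnion_atTop (μ := μ) hmono
  rw [hunion] at hlim
  have hlim' := (ENNReal.tendsto_toReal (measure_ne_top _ _)).comp hlim
  obtain ⟨n, hn⟩ := (hlim'.eventually (lt_mem_nhds hy)).exists
  filter_upwards [gt_mem_nhds (show u < u + 1 / ((n : ℝ) + 1) by
    simpa using Nat.one_div_pos_of_nat (α := ℝ))] with v hv
  exact hn.trans_le (antitone_tail Y hv.le)

lemma integrable_tail_comp (Y : Ω → ℝ) {V : Ω → ℝ} (hV : Measurable V) :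
    Integrable (fun ω => (μ {ω' | Y ω' > V ω}).toReal) μ :=
  Integrable.of_bound ((antitone_tail Y).measurable.comp hV).aestronglyMeasurable 1
    (Eventually.of_forall fun ω => by
      rw [norm_of_nonneg ENNReal.toReal_nonneg]
      exact ENNReal.toReal_mono ENNReal.one_ne_top prob_le_one)

lemma integral_tail_comp_of_indepFun {Y V : Ω → ℝ} (hY : Measurable Y) (hV : Measurable V)
    (h : IndepFun Y V μ) :
    ∫ ω, (μ {ω' | Y ω' > V ω}).toReal ∂μ = (μ {ω | Y ω > V ω}).toReal := by
  have hS : MeasurableSet {p : ℝ × ℝ | p.1 > p.2} := measurableSet_lt measurable_snd measurable_fst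
  have hmeas : Measurable fun v => μ {ω' | Y ω' > v} :=
    Antitone.measurable fun _ _ h => measure_mono fun _ hω => lt_of_le_of_lt h hω
  rw [integral_toReal (f := fun ω => μ {ω' | Y ω' > V ω}) (hmeas.comp hV).aemeasurable
    (Eventually.of_forall fun _ => measure_lt_top _ _)]
  congr 1
  have h1 : μ {ω | Y ω > V ω} = (μ.map fun ω => (Y ω, V ω)) {p : ℝ × ℝ | p.1 > p.2} := by
    rw [Measure.map_apply (hY.prodMk hV) hS]; rfl
  have : IsProbabilityMeasure (μ.map Y) := Measure.isProbabilityMeasure_map hY.aemeasurable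
  have : IsProbabilityMeasure (μ.map V) := Measure.isProbabilityMeasure_map hV.aemeasurable
  rw [h1, h.map_prod_eq_prod_map_map hY.aemeasurable hV.aemeasurable,
    Measure.prod_apply_symm hS, lintegral_map (measurable_measure_prodMk_right hS) hV]
  refine lintegral_congr fun ω => ?_
  rw [Measure.map_apply hY (measurable_prodMk_right hS)]
  rfl

lemma integral_tail_comp_le_tail {M Q Y : Ω → ℝ} (hM : Measurable M) (hQ : Measurable Q)
    (hY : Measurable Y) (hMpos : ∀ ω, 0 < M ω) (hindep : IndepFun Y (fun ω => (M ω, Q ω)) μ)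
    (hlaw : Measure.map Y μ = Measure.map (fun ω => Q ω + M ω * Y ω) μ) (u : ℝ) :
    ∫ ω, (μ {ω' | Y ω' > (u + |Q ω|) / M ω}).toReal ∂μ ≤ (μ {ω | Y ω > u}).toReal := by
  have hV : Measurable fun p : ℝ × ℝ => (u + |p.2|) / p.1 := by fun_prop
  have hind : IndepFun Y (fun ω => (u + |Q ω|) / M ω) μ := hindep.comp measurable_id hV
  rw [integral_tail_comp_of_indepFun hY (by fun_prop) hind]
  refine ENNReal.toReal_mono (measure_ne_top _ _) ?_
  have : μ {ω | Y ω > u} = μ {ω | Q ω + M ω * Y ω > u} := by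
    have := congrArg (fun ν => ν (Set.Ioi u)) hlaw
    rwa [Measure.map_apply hY measurableSet_Ioi,
      Measure.map_apply (by fun_prop) measurableSet_Ioi] at this
  rw [this]
  refine measure_mono fun ω hω => ?_
  have h1 : u + |Q ω| < Y ω * M ω := (div_lt_iff₀ (hMpos ω)).1 hω
  have h2 := neg_abs_le (Q ω)
  change u < Q ω + M ω * Y ω
  linarith

end Tail

section Subsolution

variable {Ω : Type*} [MeasurableSpace Ω] {μ : Measure Ω}
  {M Q : Ω → ℝ} {β : ℝ}

lemma norm_rpow_mul_ite_le {m q u v : ℝ} (hm : 0 < m) (hq : 0 ≤ q) (hu : 1 ≤ u) :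
    ‖m ^ β * (if v ≤ (u + q) / m then log m - log (1 + q / u) else 0)‖ ≤
      |m ^ β * log m| + m ^ β * log (1 + (m + q)) := by
  have hW : 0 < m ^ β := rpow_pos_of_pos hm β
  have h0 : 0 ≤ log (1 + q / u) := log_nonneg (by have : 0 ≤ q / u := by positivity
                                                  linarith)
  have h1 : log (1 + q / u) ≤ log (1 + (m + q)) :=
    (log_one_add_div_le hq hu).trans (log_le_log (by positivity) (by linarith))
  rw [norm_mul, norm_of_nonneg hW.le, abs_mul, abs_of_pos hW, ← mul_add]
  refine mul_le_mul_of_nonneg_left ?_ hW.le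
  split_ifs
  · refine (norm_sub_le _ _).trans ?_
    rw [norm_eq_abs, norm_of_nonneg h0]
    linarith
  · rw [norm_zero]
    linarith [abs_nonneg (log m)]

lemma measurable_rpow_mul_ite (hM : Measurable M) (hQ : Measurable Q) (u v : ℝ) :
    Measurable fun ω => M ω ^ β *
      (if v ≤ (u + |Q ω|) / M ω then log (M ω) - log (1 + |Q ω| / u) else 0) :=
  (hM.pow_const β).mul (Measurable.ite (measurableSet_le measurable_const (by fun_prop))
    (by fun_prop) measurable_const)

lemma tendsto_integral_rpow_mul_ite (hM : Measurable M) (hQ : Measurable Q)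
    (hMpos : ∀ ω, 0 < M ω) (hI : Integrable (fun ω => M ω ^ β * log (M ω)) μ)
    (hID : Integrable (fun ω => M ω ^ β * log (1 + (M ω + |Q ω|))) μ) (v : ℝ) :
    Tendsto (fun u => ∫ ω, M ω ^ β *
      (if v ≤ (u + |Q ω|) / M ω then log (M ω) - log (1 + |Q ω| / u) else 0) ∂μ) atTop
      (𝓝 (∫ ω, M ω ^ β * log (M ω) ∂μ)) := by
  refine tendsto_integral_filter_of_dominated_convergence _
    (Eventually.of_forall fun u => (measurable_rpow_mul_ite hM hQ u v).aestronglyMeasurable) ?_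
    (hI.abs.add hID) (Eventually.of_forall fun ω => ?_)
  · filter_upwards [eventually_ge_atTop 1] with u hu
    exact Eventually.of_forall fun ω => norm_rpow_mul_ite_le (hMpos ω) (abs_nonneg _) hu
  · refine Tendsto.const_mul _ ?_
    have h1 : Tendsto (fun u : ℝ => 1 + |Q ω| / u) atTop (𝓝 (1 + 0)) :=
      (tendsto_const_nhds.div_atTop tendsto_id).const_add 1
    have h2 := ((continuousAt_log (x := 1 + 0) (by norm_num)).tendsto.comp h1).const_sub
      (log (M ω))
    simp only [add_zero, log_one, sub_zero] at h2
    refine h2.congr' ?_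
    filter_upwards [eventually_ge_atTop (v * M ω)] with u hu
    rw [if_pos]
    · rfl
    · rw [le_div_iff₀ (hMpos ω)]
      linarith [abs_nonneg (Q ω)]

variable [IsProbabilityMeasure μ]

lemma integrable_rpow_mul_log (hM : Measurable M) (hMpos : ∀ ω, 0 < M ω) (hβ : 0 < β)
    (hMlog : Integrable (fun ω => M ω ^ β * max (log (M ω)) 0) μ) :
    Integrable (fun ω => M ω ^ β * log (M ω)) μ :=
  (hMlog.add (integrable_const (1 / β))).mono' (by fun_prop)
    (Eventually.of_forall fun ω => abs_rpow_mul_log_le hβ (hMpos ω))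

lemma integral_rpow_mul_log_pos (hM : Measurable M) (hMpos : ∀ ω, 0 < M ω) (hβ : 0 < β)
    (hMne1 : 0 < μ {ω | M ω ≠ 1}) (hMβint : Integrable (fun ω => M ω ^ β) μ)
    (hMβ : ∫ ω, M ω ^ β ∂μ = 1)
    (hMlog : Integrable (fun ω => M ω ^ β * max (log (M ω)) 0) μ) :
    0 < ∫ ω, M ω ^ β * log (M ω) ∂μ := by
  have hI := integrable_rpow_mul_log hM hMpos hβ hMlog
  have hI1 : Integrable (fun ω => M ω ^ β - 1) μ := hMβint.sub (integrable_const 1)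
  have hle : ∀ ω, M ω ^ β - 1 ≤ β * (M ω ^ β * log (M ω)) := fun ω => by
    have hW : 0 < M ω ^ β := rpow_pos_of_pos (hMpos ω) β
    have h := mul_le_mul_of_nonneg_left (one_sub_inv_le_log_of_pos hW) hW.le
    rw [log_rpow (hMpos ω), mul_sub, mul_inv_cancel₀ hW.ne'] at h
    linarith
  have hpos : 0 < ∫ ω, (β * (M ω ^ β * log (M ω)) - (M ω ^ β - 1)) ∂μ := by
    rw [integral_pos_iff_support_of_nonneg (fun ω => sub_nonneg.2 (hle ω))
      ((hI.const_mul β).sub hI1)]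
    refine hMne1.trans_le (measure_mono fun ω hω => ?_)
    have hW : 0 < M ω ^ β := rpow_pos_of_pos (hMpos ω) β
    have hne : (M ω ^ β)⁻¹ ≠ 1 := fun h => by
      have hlog := log_rpow (hMpos ω) β
      rw [inv_eq_one.1 h, log_one, zero_eq_mul] at hlog
      exact hω (eq_one_of_pos_of_log_eq_zero (hMpos ω) (hlog.resolve_left hβ.ne'))
    have h := mul_lt_mul_of_pos_left (log_lt_sub_one_of_pos (inv_pos.2 hW) hne) hW
    rw [log_inv, log_rpow (hMpos ω), mul_sub, mul_inv_cancel₀ hW.ne'] at h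
    refine ne_of_gt ?_
    linarith
  rw [integral_sub (hI.const_mul β) hI1,
    integral_sub hMβint (integrable_const 1), integral_const_mul, hMβ] at hpos
  simpa [hβ] using hpos

lemma integrable_rpow_mul_log_one_add (hM : Measurable M) (hQ : Measurable Q)
    (hMpos : ∀ ω, 0 < M ω) (hβ : 0 < β) (hMβint : Integrable (fun ω => M ω ^ β) μ)
    (hMlog : Integrable (fun ω => M ω ^ β * max (log (M ω)) 0) μ)
    (hQβ : Integrable (fun ω => |Q ω| ^ β) μ) :
    Integrable (fun ω => M ω ^ β * log (1 + (M ω + |Q ω|))) μ := by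
  refine (((hMlog.add (hMβint.mul_const (log 2))).add (hMlog.const_mul 2)).add
    ((((integrable_const 1).add hQβ).const_mul (2 ^ β)).const_mul (2 / β))).mono' (by fun_prop)
    (Eventually.of_forall fun ω => ?_)
  have hm := hMpos ω
  have hq := abs_nonneg (Q ω)
  have hW : 0 < M ω ^ β := rpow_pos_of_pos hm β
  rw [norm_of_nonneg (mul_nonneg hW.le (log_nonneg (by linarith)))]
  have h1 : log (1 + (M ω + |Q ω|)) ≤ log (1 + M ω) + log (1 + |Q ω|) := by
    rw [← log_mul (by positivity) (by positivity)]
    exact log_le_log (by positivity) (by nlinarith)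
  have h2 : log (1 + M ω) ≤ max (log (M ω)) 0 + log 2 := by
    rcases le_total (M ω) 1 with h | h
    · have := log_le_log (by positivity) (show 1 + M ω ≤ 2 by linarith)
      linarith [le_max_right (log (M ω)) 0]
    · have := log_le_log (by positivity) (show 1 + M ω ≤ M ω * 2 by linarith)
      rw [log_mul hm.ne' (by norm_num)] at this
      linarith [le_max_left (log (M ω)) 0]
  have h3 := rpow_mul_log_one_add_le hβ hm hq
  have h4 := mul_le_mul_of_nonneg_left (h1.trans (add_le_add_left h2 _)) hW.le
  simp only [Pi.add_apply]
  linarith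

/-- Under the moment conditions there is a bounded strict subsolution which is eventually at least
`u ^ (-β)`. -/
lemma exists_strict_subsolution (hM : Measurable M) (hQ : Measurable Q)
    (hMpos : ∀ ω, 0 < M ω) (hβ : 0 < β) (hMne1 : 0 < μ {ω | M ω ≠ 1})
    (hMβint : Integrable (fun ω => M ω ^ β) μ) (hMβ : ∫ ω, M ω ^ β ∂μ = 1)
    (hMlog : Integrable (fun ω => M ω ^ β * max (log (M ω)) 0) μ)
    (hQβ : Integrable (fun ω => |Q ω| ^ β) μ) :
    ∃ (g : ℝ → ℝ) (a : ℝ), ContinuousOn g (Set.Ici a) ∧ Tendsto g atTop (𝓝 0) ∧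
      (∀ u, g u ≤ 2) ∧ (∀ u ≥ a, u ^ (-β) ≤ g u) ∧
      (∀ u ≥ a, Integrable (fun ω => g ((u + |Q ω|) / M ω)) μ) ∧
      ∀ u ≥ a, g u < ∫ ω, g ((u + |Q ω|) / M ω) ∂μ := by
  set m := ∫ ω, M ω ^ β * log (M ω) ∂μ with hm_def
  have hm : 0 < m := integral_rpow_mul_log_pos hM hMpos hβ hMne1 hMβint hMβ hMlog
  have hI := integrable_rpow_mul_log hM hMpos hβ hMlog
  have hID := integrable_rpow_mul_log_one_add hM hQ hMpos hβ hMβint hMlog hQβ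
  have hWm : Measurable fun ω => M ω ^ β := hM.pow_const β
  have hDm : Measurable fun ω => M ω + |Q ω| := by fun_prop
  have hWpos : ∀ ω, 0 < M ω ^ β := fun ω => rpow_pos_of_pos (hMpos ω) β
  have hDpos : ∀ ω, 0 < M ω + |Q ω| := fun ω => add_pos_of_pos_of_nonneg (hMpos ω) (abs_nonneg _)
  have hW0 := fun ω => (hWpos ω).le
  have hD0 := fun ω => (hDpos ω).le
  set L := logPotential μ (fun ω => M ω ^ β) (fun ω => M ω + |Q ω|) with hL_def
  have hLanti : AntitoneOn L (Set.Ici 1) := logPotential_antitone hWm hDm hW0 hD0 hID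
  obtain ⟨C, hC0, hC⟩ : ∃ C : ℝ, 0 < C ∧ 2 * (β + 3) < C * (m / 2) := by
    refine ⟨(2 * (β + 3) + 1) / (m / 2), by positivity, ?_⟩
    rw [div_mul_cancel₀ _ (by positivity)]
    linarith
  obtain ⟨v, hv1, hv⟩ : ∃ v : ℝ, 1 ≤ v ∧ C * L v ≤ 1 := by
    have h := (tendsto_logPotential_atTop hWm hDm hW0 hD0 hID).const_mul C
    rw [mul_zero] at h
    obtain ⟨v, hv, hv1⟩ := ((h.eventually (gt_mem_nhds one_pos)).and (eventually_ge_atTop 1)).exists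
    exact ⟨v, hv1, hv.le⟩
  have hmaxv : ∀ u, 1 ≤ max u v := fun u => hv1.trans (le_max_right _ _)
  set φ : ℝ → ℝ := fun u => 1 + C * L (max u v) with hφ_def
  have hφc : Continuous φ := continuous_const.add <| continuous_const.mul <|
    (continuousOn_logPotential hWm hDm hW0 hD0 hID).comp_continuous (by fun_prop) hmaxv
  have hφ1 : ∀ u, 1 ≤ φ u := fun u => le_add_of_nonneg_right <|
    mul_nonneg hC0.le (logPotential_nonneg hW0 hD0 (hmaxv u))
  have hφ2 : ∀ u, φ u ≤ 2 := fun u => by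
    have := mul_le_mul_of_nonneg_left (hLanti hv1 (hmaxv u) (le_max_right u v)) hC0.le
    simp only [hφ_def]
    linarith
  set g : ℝ → ℝ := fun u => if 1 < u then u ^ (-β) * φ u else 0 with hg_def
  have hgm : Measurable g := Measurable.ite measurableSet_Ioi
    ((measurable_id.pow_const _).mul hφc.measurable) measurable_const
  have hg0 : ∀ u, 0 ≤ g u := fun u => by
    simp only [hg_def]
    split_ifs with h
    · exact mul_nonneg (rpow_nonneg (by linarith) _) (by linarith [hφ1 u])
    · exact le_rfl
  have hg2 : ∀ u, g u ≤ 2 := fun u => by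
    simp only [hg_def]
    split_ifs with h
    · have h1 : u ^ (-β) ≤ 1 := rpow_le_one_of_one_le_of_nonpos h.le (by linarith)
      nlinarith [hφ1 u, hφ2 u]
    · norm_num
  have hgi : ∀ u, Integrable (fun ω => g ((u + |Q ω|) / M ω)) μ := fun u =>
    Integrable.of_bound (hgm.comp (by fun_prop)).aestronglyMeasurable 2
      (Eventually.of_forall fun ω => by rw [norm_of_nonneg (hg0 _)]; exact hg2 _)
  obtain ⟨a, ha⟩ := ((tendsto_integral_rpow_mul_ite hM hQ hMpos hI hID v).eventually
    (lt_mem_nhds (half_lt_self hm))).exists_forall_of_atTop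
  refine ⟨g, max (max a v) 2, ?_, ?_, hg2, fun u hu => ?_, fun u _ => hgi u, fun u hu => ?_⟩
  · have hc : ContinuousOn (fun u : ℝ => u ^ (-β) * φ u) (Set.Ici (max (max a v) 2)) :=
      (continuousOn_id.rpow_const fun u hu => Or.inl <| ne_of_gt <|
        lt_of_lt_of_le two_pos ((le_max_right _ _).trans hu)).mul hφc.continuousOn
    refine hc.congr fun u hu => ?_
    have : (2 : ℝ) ≤ u := (le_max_right _ _).trans hu
    simp only [hg_def]
    rw [if_pos (by linarith)]
  · refine squeeze_zero' (Eventually.of_forall hg0) ?_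
      (by simpa using (tendsto_rpow_neg_atTop hβ).mul_const 2)
    filter_upwards [eventually_gt_atTop 1] with u hu
    simp only [hg_def]
    rw [if_pos hu]
    exact mul_le_mul_of_nonneg_left (hφ2 u) (rpow_nonneg (by linarith) _)
  · have hu2 : (2 : ℝ) ≤ u := (le_max_right _ _).trans hu
    simp only [hg_def]
    rw [if_pos (by linarith)]
    exact le_mul_of_one_le_right (rpow_nonneg (by linarith) _) (hφ1 u)
  · have hu2 : (2 : ℝ) ≤ u := (le_max_right _ _).trans hu
    have hua : a ≤ u := (le_max_left _ _).trans ((le_max_left _ _).trans hu)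
    have huv : v ≤ u := (le_max_right _ _).trans ((le_max_left _ _).trans hu)
    have hu0 : 0 < u := by linarith
    have hu1 : 1 ≤ u := by linarith
    set ε := ∫ ω, M ω ^ β * ((M ω + |Q ω|) / (M ω + |Q ω| + u)) ∂μ with hε_def
    have hεi := integrable_mul_div_add hWm hDm hW0 hD0 hMβint hu0
    have hε : 0 < ε := by
      have hpos : ∀ ω, 0 < M ω ^ β * ((M ω + |Q ω|) / (M ω + |Q ω| + u)) := fun ω =>
        mul_pos (hWpos ω) (div_pos (hDpos ω) (by linarith [hDpos ω]))
      rw [hε_def, integral_pos_iff_support_of_nonneg (fun ω => (hpos ω).le) hεi]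
      have : Function.support (fun ω => M ω ^ β * ((M ω + |Q ω|) / (M ω + |Q ω| + u))) =
          Set.univ := Set.eq_univ_of_forall fun ω => (hpos ω).ne'
      rw [this, measure_univ]
      exact one_pos
    set t : Ω → ℝ := fun ω =>
      if v ≤ (u + |Q ω|) / M ω then log (M ω) - log (1 + |Q ω| / u) else 0 with ht_def
    have hti : Integrable (fun ω => M ω ^ β * t ω) μ :=
      (hI.abs.add hID).mono' (measurable_rpow_mul_ite hM hQ u v).aestronglyMeasurable
        (Eventually.of_forall fun ω => norm_rpow_mul_ite_le (hMpos ω) (abs_nonneg _) hu1)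
    have hφt : ∀ ω, φ u + C * ε * t ω ≤ φ ((u + |Q ω|) / M ω) := fun ω => by
      have hq := abs_nonneg (Q ω)
      simp only [hφ_def, ht_def, max_eq_left huv]
      split_ifs with h
      · have h1 := integral_mul_div_add_mul_le_logPotential_sub hWm hDm hW0 hD0 hMβint hID hu1
          (hv1.trans h)
        have h2 : log u - log ((u + |Q ω|) / M ω) = log (M ω) - log (1 + |Q ω| / u) := by
          have : 1 + |Q ω| / u = (u + |Q ω|) / u := by field_simp
          rw [this, log_div (by positivity) (hMpos ω).ne', log_div (by positivity) hu0.ne']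
          ring
        rw [h2] at h1
        have h3 := mul_le_mul_of_nonneg_left h1 hC0.le
        rw [max_eq_left h]
        linarith
      · have h1 := hLanti (hmaxv ((u + |Q ω|) / M ω)) hu1 (max_le (not_le.1 h).le le_rfl |>.trans huv)
        have h3 := mul_le_mul_of_nonneg_left h1 hC0.le
        linarith
    have hpt : ∀ ω, φ u * M ω ^ β + C * ε * (M ω ^ β * t ω) -
        2 * (β + 3) * (M ω ^ β * ((M ω + |Q ω|) / (M ω + |Q ω| + u))) ≤
        u ^ β * g ((u + |Q ω|) / M ω) := fun ω => by
      have h1 := rpow_mul_sub_le_mul_ite hβ (hMpos ω) (abs_nonneg (Q ω)) hu0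
        (zero_le_one.trans (hφ1 ((u + |Q ω|) / M ω))) (hφ2 ((u + |Q ω|) / M ω))
      have h2 := mul_le_mul_of_nonneg_left (hφt ω) (hW0 ω)
      simp only [hg_def]
      linarith
    have hsum : Integrable (fun ω => φ u * M ω ^ β + C * ε * (M ω ^ β * t ω)) μ :=
      (hMβint.const_mul (φ u)).add (hti.const_mul (C * ε))
    have hint := integral_mono (hsum.sub (hεi.const_mul (2 * (β + 3))))
      ((hgi u).const_mul (u ^ β)) hpt
    simp only [Pi.sub_apply] at hint
    rw [integral_sub hsum (hεi.const_mul (2 * (β + 3))),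
      integral_add (hMβint.const_mul (φ u)) (hti.const_mul (C * ε)), integral_const_mul,
      integral_const_mul, integral_const_mul, integral_const_mul, hMβ, ← hε_def] at hint
    have hdrift : C * ε * (m / 2) < C * ε * ∫ ω, M ω ^ β * t ω ∂μ :=
      mul_lt_mul_of_pos_left (ha u hua) (by positivity)
    have hgain : ε * (2 * (β + 3)) < ε * (C * (m / 2)) := mul_lt_mul_of_pos_left hC hε
    have hmain : φ u < u ^ β * ∫ ω, g ((u + |Q ω|) / M ω) ∂μ := by linarith
    have hgu : g u = u ^ (-β) * φ u := if_pos (by linarith)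
    rw [hgu, rpow_neg hu0.le, inv_mul_lt_iff₀ (rpow_pos_of_pos hu0 β)]
    exact hmain

end Subsolution

lemma tail_positivity_of_forall_pos {Ω : Type*} [MeasurableSpace Ω] {μ : Measure Ω}
    [IsProbabilityMeasure μ] {M Q Y : Ω → ℝ} (hM : Measurable M) (hQ : Measurable Q)
    (hY : Measurable Y) (hMpos : ∀ ω, 0 < M ω) (hMne1 : 0 < μ {ω | M ω ≠ 1})
    {β : ℝ} (hβ : 0 < β) (hMβint : Integrable (fun ω => M ω ^ β) μ)
    (hMβ : ∫ ω, M ω ^ β ∂μ = 1)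
    (hMlog : Integrable (fun ω => M ω ^ β * max (log (M ω)) 0) μ)
    (hQβ : Integrable (fun ω => |Q ω| ^ β) μ)
    (hindep : IndepFun Y (fun ω => (M ω, Q ω)) μ)
    (hlaw : Measure.map Y μ = Measure.map (fun ω => Q ω + M ω * Y ω) μ)
    (hunbdd : ∀ u : ℝ, 0 < μ {ω | Y ω > u}) :
    ∃ c : ℝ, 0 < c ∧ ∀ᶠ u : ℝ in atTop, c ≤ u ^ β * (μ {ω | Y ω > u}).toReal := by
  obtain ⟨g, a, hgc, hg0, hg2, hga, hgi, hgT⟩ :=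
    exists_strict_subsolution hM hQ hMpos hβ hMne1 hMβint hMβ hMlog hQβ
  have hFa : 0 < (μ {ω | Y ω > a}).toReal := ENNReal.toReal_pos (hunbdd a).ne' (measure_ne_top _ _)
  set c := (μ {ω | Y ω > a}).toReal / 2 with hc_def
  have hc : 0 < c := half_pos hFa
  have hcomp := le_of_strict_subsolution (μ := μ) (T := fun u ω => (u + |Q ω|) / M ω)
    (F := fun u => (μ {ω | Y ω > u}).toReal) (g := fun u => c * g u) (a := a)
    lowerSemicontinuous_tail (fun _ => ENNReal.toReal_nonneg) (continuousOn_const.mul hgc)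
    (by simpa using hg0.const_mul c)
    (fun u hu => by
      have h1 : (μ {ω | Y ω > a}).toReal ≤ (μ {ω | Y ω > u}).toReal := antitone_tail Y hu
      have h2 := mul_le_mul_of_nonneg_left (hg2 u) hc.le
      linarith)
    (fun u _ => integrable_tail_comp Y (by fun_prop))
    (fun u hu => (hgi u hu).const_mul c)
    (fun u _ => integral_tail_comp_le_tail hM hQ hY hMpos hindep hlaw u)
    (fun u hu => by
      rw [integral_const_mul]
      exact mul_lt_mul_of_pos_left (hgT u hu) hc)
  refine ⟨c, hc, ?_⟩
  filter_upwards [eventually_ge_atTop a, eventually_gt_atTop 0] with u hua hu0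
  have h1 := (mul_le_mul_of_nonneg_left (hga u hua) hc.le).trans (hcomp u)
  rwa [rpow_neg hu0.le, ← div_eq_mul_inv, div_le_iff₀' (rpow_pos_of_pos hu0 β)] at h1

/-- **Guivarc'h–Le Page / Buraczewski–Damek positivity criterion.** If `Y` is independent of
`(M, Q)`, solves the distributional equation `Y =d Q + M * Y`, for some `β > 0` one has
`E[M^β] = 1`, `E[M^β (log M)⁺] < ∞` and `E[|Q|^β] < ∞`, and the support of the law of `Y` is
unbounded from above, then `liminf_{u→∞} u^β P(Y > u) > 0`. -/
theorem tail_positivity_criterion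
    {Ω : Type*} [MeasurableSpace Ω] (μ : Measure Ω) [IsProbabilityMeasure μ]
    (M Q Y : Ω → ℝ) (hMmeas : Measurable M) (hQmeas : Measurable Q) (hYmeas : Measurable Y)
    (hMpos : ∀ᵐ ω ∂μ, 0 < M ω)
    (hMne1 : 0 < μ {ω | M ω ≠ 1})
    (β : ℝ) (hβ : 0 < β)
    (hMβint : Integrable (fun ω => M ω ^ β) μ)
    (hMβ : ∫ ω, M ω ^ β ∂μ = 1)
    (hMlog : Integrable (fun ω => M ω ^ β * max (Real.log (M ω)) 0) μ)
    (hQβ : Integrable (fun ω => |Q ω| ^ β) μ)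
    (hindep : IndepFun Y (fun ω => (M ω, Q ω)) μ)
    (hlaw : Measure.map Y μ = Measure.map (fun ω => Q ω + M ω * Y ω) μ)
    (hunbdd : ∀ u : ℝ, 0 < μ {ω | Y ω > u}) :
    ∃ c : ℝ, 0 < c ∧ ∀ᶠ u : ℝ in atTop,
      c ≤ u ^ β * (μ {ω | Y ω > u}).toReal := by
  set M' : Ω → ℝ := fun ω => if 0 < M ω then M ω else 1 with hM'_def
  have hM'meas : Measurable M' :=
    Measurable.ite (measurableSet_lt measurable_const hMmeas) hMmeas measurable_const
  have hM'pos : ∀ ω, 0 < M' ω := fun ω => by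
    simp only [hM'_def]
    split_ifs with h
    · exact h
    · exact one_pos
  have hae : M =ᵐ[μ] M' := hMpos.mono fun ω hω => (if_pos hω).symm
  refine tail_positivity_of_forall_pos hM'meas hQmeas hYmeas hM'pos ?_ hβ ?_ ?_ ?_ hQβ ?_ ?_ hunbdd
  · refine hMne1.trans_eq (measure_congr ?_)
    filter_upwards [hae] with ω hω
    exact congrArg (· ≠ (1 : ℝ)) hω
  · exact hMβint.congr (hae.mono fun ω hω => by simp only [hω])
  · rw [← hMβ]
    exact integral_congr_ae (hae.mono fun ω hω => by simp only [hω])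
  · exact hMlog.congr (hae.mono fun ω hω => by simp only [hω])
  · exact hindep.congr Filter.EventuallyEq.rfl (hae.mono fun ω hω => by simp only [hω])
  · rw [hlaw]
    exact Measure.map_congr (hae.mono fun ω hω => by simp only [hω])
end
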